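/- Fix α ∈ (0,3) and m with 3 - α < m < 3. There is a constant C = C(α,m) such that for all v ∈ ℝ³, ∫_{ℝ³} |v-w|^{-α} ⟨w⟩^{-m} dw ≤ C ⟨v⟩^{3-α-m}, where ⟨w⟩ = (1+|w|²)^{1/2}. -/

import Mathlib

open MeasureTheory Set

lemma rcl_integrable (s r : ℝ) (hs : s < 3) (hr : 0 < r) :
    Integrable (fun x : EuclideanSpace ℝ (Fin 3) =>
      (Iio r).indicator (fun t : ℝ => t ^ (-s)) ‖x‖) := by
  rw [integrable_fun_norm_addHaar volume (f := (Iio r).indicator (fun t : ℝ => t ^ (-s)))]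
  have h1 : IntegrableOn (fun t : ℝ => t ^ (2 - s)) (Ioo 0 r) := by
    rw [intervalIntegral.integrableOn_Ioo_rpow_iff hr]; linarith
  have h2 := h1.integrable_indicator measurableSet_Ioo
  refine (h2.integrableOn (s := Ioi 0)).congr_fun ?_ measurableSet_Ioi
  intro y hy
  have hy : 0 < y := hy
  by_cases hyr : y < r
  · have : y ^ (2 - s) = y ^ 2 * y ^ (-s) := by
      rw [← Real.rpow_natCast y 2, ← Real.rpow_add hy]; norm_num [sub_eq_add_neg]
    simp [indicator, hy, hyr, this]
  · simp [indicator, hyr]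

lemma rcl_anti {x y s : ℝ} (hx : 0 < x) (h : x ≤ y) (hs : 0 ≤ s) : y ^ (-s) ≤ x ^ (-s) :=
  Real.rpow_le_rpow_of_nonpos hx h (by linarith)

lemma rcl_inv {c s : ℝ} (hc : 0 < c) : (1 / c) ^ (-s) = c ^ s := by
  rw [Real.rpow_neg (by positivity), one_div, Real.inv_rpow hc.le, inv_inv]

lemma rcl_pointwise (α m : ℝ) (hα : 0 < α) (hm : 0 < m) (e u : EuclideanSpace ℝ (Fin 3))
    (he : ‖e‖ < 1) (hu : u ≠ 0) (B : ℝ) (hB : 0 < B) (hB2 : B ^ 2 = 1 - ‖e‖ ^ 2 + ‖u‖ ^ 2) :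
    ‖e - u‖ ^ (-α) * B ^ (-m) ≤
      4 ^ m * (Iio (1/4 : ℝ)).indicator (fun t : ℝ => t ^ (-α)) ‖u - e‖
      + 4 ^ α * (Iio (2 : ℝ)).indicator (fun t : ℝ => t ^ (-m)) ‖u‖
      + 3 ^ (α + m) * (1 + ‖u‖) ^ (-(α + m)) := by
  have hn : 0 < ‖u‖ := norm_pos_iff.2 hu
  have he0 := norm_nonneg e
  have hBu : ‖u‖ ≤ B := by
    apply le_of_sq_le_sq _ hB.le
    nlinarith
  have i1 : 0 ≤ (Iio (1/4 : ℝ)).indicator (fun t : ℝ => t ^ (-α)) ‖u - e‖ := by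
    by_cases h : ‖u - e‖ < 1/4
    · rw [indicator_of_mem (by exact h)]; positivity
    · rw [indicator_of_notMem (by exact h)]
  have i2 : 0 ≤ (Iio (2 : ℝ)).indicator (fun t : ℝ => t ^ (-m)) ‖u‖ := by
    by_cases h : ‖u‖ < 2
    · rw [indicator_of_mem (by exact h)]; positivity
    · rw [indicator_of_notMem (by exact h)]
  have i1' : 0 ≤ (4:ℝ) ^ m * (Iio (1/4 : ℝ)).indicator (fun t : ℝ => t ^ (-α)) ‖u - e‖ := by
    positivity
  have i2' : 0 ≤ (4:ℝ) ^ α * (Iio (2 : ℝ)).indicator (fun t : ℝ => t ^ (-m)) ‖u‖ := by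
    positivity
  have i3' : 0 ≤ (3:ℝ) ^ (α + m) * (1 + ‖u‖) ^ (-(α + m)) := by positivity
  have hsym : ‖e - u‖ = ‖u - e‖ := norm_sub_rev _ _
  by_cases h1 : ‖u - e‖ < 1/4
  · have hB4 : 1/4 ≤ B := by
      by_cases h : ‖e‖ ≤ 1/2
      · apply le_of_sq_le_sq _ hB.le
        nlinarith
      · have := norm_sub_norm_le e u
        linarith
    have := rcl_anti (by norm_num) hB4 hm.le
    rw [rcl_inv (by norm_num)] at this
    have : ‖e - u‖ ^ (-α) * B ^ (-m) ≤ 4 ^ m * ‖u - e‖ ^ (-α) := by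
      rw [hsym, mul_comm]; gcongr
    rw [indicator_of_mem (show ‖u - e‖ ∈ Iio (1/4:ℝ) from h1)] at *
    linarith
  · push Not at h1
    by_cases h2 : ‖u‖ < 2
    · have a1 := rcl_anti (by norm_num) h1 hα.le
      rw [rcl_inv (by norm_num), ← hsym] at a1
      have a2 := rcl_anti hn hBu hm.le
      have : ‖e - u‖ ^ (-α) * B ^ (-m) ≤ 4 ^ α * ‖u‖ ^ (-m) := by gcongr
      rw [indicator_of_mem (show ‖u‖ ∈ Iio (2:ℝ) from h2)] at *
      linarith
    · push Not at h2
      have t := norm_sub_norm_le u e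
      have a1 := rcl_anti (x := 1/3 * (1 + ‖u‖)) (y := ‖e - u‖) (by positivity)
        (by rw [hsym]; linarith) hα.le
      have a2 := rcl_anti (x := 1/3 * (1 + ‖u‖)) (y := B) (by positivity)
        (by linarith) hm.le
      have a3 : (1/3 * (1 + ‖u‖)) ^ (-α) * (1/3 * (1 + ‖u‖)) ^ (-m)
          = 3 ^ (α + m) * (1 + ‖u‖) ^ (-(α + m)) := by
        rw [← Real.rpow_add (by positivity), ← neg_add,
          Real.mul_rpow (by norm_num) (by positivity), rcl_inv (by norm_num)]
      have : ‖e - u‖ ^ (-α) * B ^ (-m)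
          ≤ (1/3 * (1 + ‖u‖)) ^ (-α) * (1/3 * (1 + ‖u‖)) ^ (-m) := by gcongr
      linarith

/-- Weighted convolution estimate for the Riesz kernel, case `3 - α < m < 3`:
`∫ |v-w|^{-α} ⟨w⟩^{-m} dw ≲ ⟨v⟩^{3-α-m}`. -/
theorem riesz_convolution_low (α m : ℝ) (hα : α ∈ Ioo (0:ℝ) 3)
    (hm1 : 3 - α < m) (hm2 : m < 3) :
    ∃ C > 0, ∀ v : EuclideanSpace ℝ (Fin 3),
      (∫ w : EuclideanSpace ℝ (Fin 3),
          ‖v - w‖ ^ (-α) * ((1 + ‖w‖ ^ 2) ^ ((1:ℝ)/2)) ^ (-m))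
        ≤ C * ((1 + ‖v‖ ^ 2) ^ ((1:ℝ)/2)) ^ (3 - α - m) := by
  obtain ⟨hα0, hα3⟩ := hα
  have hm0 : 0 < m := by linarith
  set g1 : EuclideanSpace ℝ (Fin 3) → ℝ :=
    fun x => (Iio (1/4 : ℝ)).indicator (fun t : ℝ => t ^ (-α)) ‖x‖ with hg1
  set g2 : EuclideanSpace ℝ (Fin 3) → ℝ :=
    fun x => (Iio (2 : ℝ)).indicator (fun t : ℝ => t ^ (-m)) ‖x‖ with hg2
  set g3 : EuclideanSpace ℝ (Fin 3) → ℝ := fun x => (1 + ‖x‖) ^ (-(α + m)) with hg3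
  have I1 : Integrable g1 := rcl_integrable α _ hα3 (by norm_num)
  have I2 : Integrable g2 := rcl_integrable m _ hm2 (by norm_num)
  have I3 : Integrable g3 := integrable_one_add_norm (by simp; linarith)
  refine ⟨|4 ^ m * (∫ x, g1 x) + 4 ^ α * (∫ x, g2 x) + 3 ^ (α + m) * (∫ x, g3 x)| + 1,
    by positivity, fun v => ?_⟩
  have hJp : 0 < (1 + ‖v‖ ^ 2) ^ ((1:ℝ)/2) := by positivity
  have hJ2 : ((1 + ‖v‖ ^ 2) ^ ((1:ℝ)/2)) ^ 2 = 1 + ‖v‖ ^ 2 := by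
    rw [← Real.sqrt_eq_rpow, Real.sq_sqrt (by positivity)]
  generalize (1 + ‖v‖ ^ 2) ^ ((1:ℝ)/2) = J at hJp hJ2 ⊢
  set e := J⁻¹ • v with hedef
  have hv : v = J • e := by rw [hedef, smul_smul, mul_inv_cancel₀ hJp.ne', one_smul]
  have hvn : ‖v‖ = J * ‖e‖ := by rw [hv, norm_smul, Real.norm_of_nonneg hJp.le]
  have hJe : 1 = J ^ 2 * (1 - ‖e‖ ^ 2) := by rw [hvn] at hJ2; linarith
  have he2 : 0 < 1 - ‖e‖ ^ 2 := by
    by_contra h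
    push Not at h
    nlinarith [sq_nonneg J]
  have he : ‖e‖ < 1 := by nlinarith [norm_nonneg e]
  set F : EuclideanSpace ℝ (Fin 3) → ℝ :=
    fun w => ‖v - w‖ ^ (-α) * ((1 + ‖w‖ ^ 2) ^ ((1:ℝ)/2)) ^ (-m) with hF
  have hscale : ∫ w, F w = J ^ 3 * ∫ u, F (J • u) := by
    rw [Measure.integral_comp_smul_of_nonneg volume F J (hR := hJp.le)]
    simp
    field_simp
  have hFu : ∀ u, F (J • u) = J ^ (-α - m) *
      (‖e - u‖ ^ (-α) * (Real.sqrt (1 - ‖e‖ ^ 2 + ‖u‖ ^ 2)) ^ (-m)) := by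
    intro u
    have h1 : ‖v - J • u‖ = J * ‖e - u‖ := by
      rw [hv, ← smul_sub, norm_smul, Real.norm_of_nonneg hJp.le]
    have h2 : (1 + ‖J • u‖ ^ 2) ^ ((1:ℝ)/2) = J * Real.sqrt (1 - ‖e‖ ^ 2 + ‖u‖ ^ 2) := by
      rw [← Real.sqrt_eq_rpow, norm_smul, Real.norm_of_nonneg hJp.le]
      have : 1 + (J * ‖u‖) ^ 2 = J ^ 2 * (1 - ‖e‖ ^ 2 + ‖u‖ ^ 2) := by
        linear_combination hJe
      rw [this, Real.sqrt_mul (by positivity), Real.sqrt_sq hJp.le]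
    simp only [hF]
    rw [h1, h2, Real.mul_rpow hJp.le (norm_nonneg _), Real.mul_rpow hJp.le (Real.sqrt_nonneg _),
      sub_eq_add_neg (-α) m, Real.rpow_add hJp]
    ring
  have hmain : ∫ u, ‖e - u‖ ^ (-α) * (Real.sqrt (1 - ‖e‖ ^ 2 + ‖u‖ ^ 2)) ^ (-m) ≤
      4 ^ m * (∫ x, g1 x) + 4 ^ α * (∫ x, g2 x) + 3 ^ (α + m) * (∫ x, g3 x) := by
    have J1 : Integrable (fun u => 4 ^ m * g1 (u - e)) := (I1.comp_sub_right e).const_mul _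
    have J2 : Integrable (fun u => 4 ^ α * g2 u) := I2.const_mul _
    have J3 : Integrable (fun u => 3 ^ (α + m) * g3 u) := I3.const_mul _
    have J12 : Integrable (fun u => 4 ^ m * g1 (u - e) + 4 ^ α * g2 u) := J1.add J2
    have hr : ∫ u, (4 ^ m * g1 (u - e) + 4 ^ α * g2 u + 3 ^ (α + m) * g3 u) =
      4 ^ m * (∫ x, g1 x) + 4 ^ α * (∫ x, g2 x) + 3 ^ (α + m) * (∫ x, g3 x) := by
      rw [integral_add J12 J3, integral_add J1 J2, integral_const_mul,
        integral_const_mul, integral_const_mul, integral_sub_right_eq_self g1 e]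
    rw [← hr]
    refine integral_mono_of_nonneg (Filter.Eventually.of_forall fun u => ?_)
      (J12.add J3) ?_
    · simp only [Pi.zero_apply]; positivity
    · have : ∀ᵐ u : EuclideanSpace ℝ (Fin 3), u ≠ 0 := by
        simp [ae_iff]
      filter_upwards [this] with u hu
      exact rcl_pointwise α m hα0 hm0 e u he hu _ (Real.sqrt_pos.2 (by positivity))
        (Real.sq_sqrt (by positivity))
  rw [hscale]
  simp only [hFu]
  rw [integral_const_mul, ← mul_assoc]
  have hJJ : J ^ 3 * J ^ (-α - m) = J ^ (3 - α - m) := by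
    rw [← Real.rpow_natCast J 3, ← Real.rpow_add hJp]
    congr 1; push_cast; ring
  rw [hJJ, mul_comm]
  gcongr
  exact hmain.trans ((le_abs_self _).trans (by linarith))
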